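/- (Monotonicity.) Let ξ be a fixed stack array. Let V ⊆ V′ be subsets of ℤ and let η ≤ η′ be configurations. Suppose there exists a legal toppling sequence for η contained in V stabilizing η in V, and a legal toppling sequence for η′ contained in V′ stabilizing η′ in V′. Then the corresponding odometers satisfy u_{η,V} ≤ u_{η′,V′} pointwise. -/

import Mathlib

/-!
Activated Random Walk: configurations, stacks, toppling, Abelian property.

Configurations are elements of `Ω = (ℕ ∪ {ρ})^ℤ`; `num n` means `n` active particles,
`rho` a single sleeping particle.  A stack array assigns to each site `x` and each
index `j` an instruction `τ_{x,x-1}`, `τ_{x,x+1}` or `τ_{x,ρ}` (encoded as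
`left`, `right`, `sleep`).  Toppling at `x` uses the first unused instruction of the
stack at `x` (indices start at `0`, i.e. the `(h x + 1)`-st instruction).
-/

/-- The state of a single site: `num n` = `n` active particles, `rho` = one sleeping
particle. -/
inductive ARWState where
  | num : ℕ → ARWState
  | rho : ARWState
deriving DecidableEq

/-- Configurations on `ℤ`. -/
abbrev Config := ℤ → ARWState

/-- Adding one (active) particle to a site: `ρ + 1 = 2`. -/
def ARWState.inc : ARWState → ARWState
  | .num n => .num (n + 1)
  | .rho => .num 2

/-- Removing one active particle from a site (only meaningful at unstable sites). -/
def ARWState.dec : ARWState → ARWState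
  | .num (n + 1) => .num n
  | s => s

/-- The effect of a sleep instruction `τ_{x,ρ}`: `ρ·1 = ρ`, `ρ·n = n` for `n > 1`. -/
def ARWState.toSleep : ARWState → ARWState
  | .num 1 => .rho
  | s => s

/-- A site `x` is unstable in `η` if it carries at least one active particle. -/
def Unstable (η : Config) (x : ℤ) : Prop := ∃ n : ℕ, 1 ≤ n ∧ η x = .num n

/-- The three kinds of instructions at a site `x`: `τ_{x,x-1}`, `τ_{x,x+1}`, `τ_{x,ρ}`. -/
inductive Instr where
  | left : Instr
  | right : Instr
  | sleep : Instr
deriving DecidableEq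

/-- The action of an instruction at site `x` on a configuration. -/
def applyInstr (ι : Instr) (x : ℤ) (η : Config) : Config :=
  match ι with
  | .left => fun z => if z = x then (η x).dec else if z = x - 1 then (η (x - 1)).inc else η z
  | .right => fun z => if z = x then (η x).dec else if z = x + 1 then (η (x + 1)).inc else η z
  | .sleep => fun z => if z = x then (η x).toSleep else η z

/-- A stack array `ξ = (ξ_{(x,j)})`. -/
abbrev Stacks := ℤ → ℕ → Instr

/-- One toppling at `x`, acting on a pair (configuration, odometer): it uses the first
unused instruction `ξ_{(x, h x + 1)}` of the stack at `x` and increases the odometer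
at `x` by one. -/
def toppleOne (ξ : Stacks) (x : ℤ) (p : Config × (ℤ → ℕ)) : Config × (ℤ → ℕ) :=
  (applyInstr (ξ x (p.2 x)) x p.1, Function.update p.2 x (p.2 x + 1))

/-- Toppling along a finite sequence `α = (x₁, …, x_k)`, i.e. `Φ_α = Φ_{x_k} ∘ ⋯ ∘ Φ_{x_1}`. -/
def toppleSeq (ξ : Stacks) : List ℤ → Config × (ℤ → ℕ) → Config × (ℤ → ℕ)
  | [], p => p
  | x :: α, p => toppleSeq ξ α (toppleOne ξ x p)

/-- Legality of a toppling sequence: each successive toppling happens at a site that is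
unstable in the configuration at that stage. -/
def LegalFrom (ξ : Stacks) : List ℤ → Config × (ℤ → ℕ) → Prop
  | [], _ => True
  | x :: α, p => Unstable p.1 x ∧ LegalFrom ξ α (toppleOne ξ x p)

/-- `Φ_α(η)`: the configuration resulting from toppling the sequence `α` starting from `η`
(and odometer `0`). -/
def topple (ξ : Stacks) (α : List ℤ) (η : Config) : Config :=
  (toppleSeq ξ α (η, fun _ => 0)).1

/-- `α` is a legal toppling sequence for `η` (with fresh stacks). -/
def LegalSeq (ξ : Stacks) (α : List ℤ) (η : Config) : Prop :=
  LegalFrom ξ α (η, fun _ => 0)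

/-- A toppling sequence is contained in `V` if all its entries lie in `V`. -/
def ContainedIn (α : List ℤ) (V : Set ℤ) : Prop := ∀ x ∈ α, x ∈ V

/-- `α` stabilizes `η` in `V` if every site of `V` is stable in `Φ_α(η)`. -/
def StabilizesIn (ξ : Stacks) (α : List ℤ) (η : Config) (V : Set ℤ) : Prop :=
  ∀ x ∈ V, ¬ Unstable (topple ξ α η) x

/-- The linear order `0 < ρ < 1 < 2 < ⋯` on `ℕ ∪ {ρ}`, realized by the embedding
`num n ↦ n`, `ρ ↦ 1/2` into `ℚ`. -/
def ARWState.val : ARWState → ℚ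
  | .num n => n
  | .rho => 1 / 2

/-- Pointwise order on configurations (with `0 < ρ < 1 < 2 < ⋯` at each site). -/
def ConfigLE (η η' : Config) : Prop := ∀ x : ℤ, (η x).val ≤ (η' x).val

def ARWState.sz : ARWState → ℕ
  | .num n => n
  | .rho => 1

lemma sz_num (n : ℕ) : (ARWState.num n).sz = n := rfl

lemma sz_rho : ARWState.rho.sz = 1 := rfl

def arr (ξ : Stacks) (h : ℤ → ℕ) (z : ℤ) : ℕ :=
  Nat.count (fun j => ξ (z - 1) j = .right) (h (z - 1)) +
    Nat.count (fun j => ξ (z + 1) j = .left) (h (z + 1))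

def dep (ξ : Stacks) (z : ℤ) (k : ℕ) : ℕ := Nat.count (fun j => ¬ ξ z j = .sleep) k

def LastSl (ξ : Stacks) (η : Config) (z : ℤ) : ℕ → Prop
  | 0 => η z = .rho
  | k + 1 => ξ z k = .sleep

def ArwInv (ξ : Stacks) (η : Config) (p : Config × (ℤ → ℕ)) : Prop :=
  ∀ z, (p.1 z).sz + dep ξ z (p.2 z) = (η z).sz + arr ξ p.2 z ∧
    (LastSl ξ η z (p.2 z) → p.1 z = .rho ∨ ∃ n, p.1 z = .num (n + 2)) ∧
    (¬ LastSl ξ η z (p.2 z) → ∃ n, p.1 z = .num n)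

lemma inv_init (ξ : Stacks) (η : Config) : ArwInv ξ η (η, fun _ => 0) := by
  intro z
  refine ⟨by simp [dep, arr], fun h => Or.inl h, fun h => ?_⟩
  simp only [LastSl] at h
  cases hz : η z with
  | num n => exact ⟨n, hz⟩
  | rho => exact absurd hz h

lemma inv_step (ξ : Stacks) (η : Config) (x : ℤ) (p : Config × (ℤ → ℕ))
    (hu : Unstable p.1 x) (hI : ArwInv ξ η p) : ArwInv ξ η (toppleOne ξ x p) := by
  obtain ⟨ζ, h⟩ := p
  obtain ⟨n, hn, hx⟩ := hu
  obtain ⟨n, rfl⟩ : ∃ m, n = m + 1 := ⟨n - 1, by omega⟩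
  simp only at hx
  intro z
  obtain ⟨h1, h2, h3⟩ := hI z
  simp only at h1 h2 h3
  by_cases hzx : z = x
  · subst hzx
    have e1 : z - 1 ≠ z := by omega
    have e2 : z + 1 ≠ z := by omega
    simp only [hx, sz_num, sz_rho, dep, arr] at h1
    cases hi : ξ z (h z) <;>
      simp [toppleOne, applyInstr, hi, hx, dep, arr, Nat.count_succ, LastSl, ARWState.dec, sz_num, sz_rho,
        Function.update_of_ne e1, Function.update_of_ne e2]
    · omega
    · omega
    · cases n with
      | zero => simp [ARWState.toSleep, sz_rho]; omega
      | succ n => simp [ARWState.toSleep, sz_num]; omega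
  · by_cases hzl : z = x - 1
    · subst hzl
      have e1 : x - 1 - 1 ≠ x := by omega
      have e3 : x - 1 + 1 = x := by omega
      have e4 : x - 1 ≠ x + 1 := by omega
      simp only [dep, arr, e3] at h1
      cases hi : ξ x (h x) <;>
        simp [toppleOne, applyInstr, hi, dep, arr, Nat.count_succ, e1, e4]
      · refine ⟨?_, fun hL => ?_, fun hL => ?_⟩
        · cases hs : ζ (x - 1) <;> simp [hs, ARWState.inc, sz_num, sz_rho] at h1 ⊢ <;> omega
        · rcases h2 hL with hs | ⟨m, hs⟩ <;> simp [hs, ARWState.inc]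
        · obtain ⟨m, hs⟩ := h3 hL; simp [hs, ARWState.inc]
      · exact ⟨by simpa using h1, h2, h3⟩
      · exact ⟨by simpa using h1, h2, h3⟩
    · by_cases hzr : z = x + 1
      · subst hzr
        have e1 : x + 1 + 1 ≠ x := by omega
        have e3 : x + 1 - 1 = x := by omega
        have e4 : x + 1 ≠ x - 1 := by omega
        simp only [dep, arr, e3] at h1
        cases hi : ξ x (h x) <;>
          simp [toppleOne, applyInstr, hi, dep, arr, Nat.count_succ, e1, e4]
        · exact ⟨by simpa using h1, h2, h3⟩
        · refine ⟨?_, fun hL => ?_, fun hL => ?_⟩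
          · cases hs : ζ (x + 1) <;> simp [hs, ARWState.inc, sz_num, sz_rho] at h1 ⊢ <;> omega
          · rcases h2 hL with hs | ⟨m, hs⟩ <;> simp [hs, ARWState.inc]
          · obtain ⟨m, hs⟩ := h3 hL; simp [hs, ARWState.inc]
        · exact ⟨by simpa using h1, h2, h3⟩
      · have e1 : z - 1 ≠ x := by omega
        have e2 : z + 1 ≠ x := by omega
        have c : (toppleOne ξ x (ζ, h)).1 z = ζ z := by
          cases hi : ξ x (h x) <;> simp [toppleOne, applyInstr, hi, hzx, hzl, hzr]
        rw [c]
        simp only [toppleOne, arr, Function.update_of_ne e1, Function.update_of_ne e2,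
          Function.update_of_ne hzx]
        exact ⟨h1, h2, h3⟩

lemma inv_seq (ξ : Stacks) (η : Config) (α : List ℤ) : ∀ p : Config × (ℤ → ℕ),
    LegalFrom ξ α p → ArwInv ξ η p → ArwInv ξ η (toppleSeq ξ α p) := by
  induction α with
  | nil => intro p _ h; exact h
  | cons x α ih => intro p hl h; exact ih _ hl.2 (inv_step ξ η x p hl.1 h)

lemma odo_seq (ξ : Stacks) (α : List ℤ) : ∀ (p : Config × (ℤ → ℕ)) (z : ℤ),
    (toppleSeq ξ α p).2 z = p.2 z + α.count z := by
  induction α with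
  | nil => intro p z; simp [toppleSeq]
  | cons x α ih =>
    intro p z
    rw [toppleSeq, ih]
    by_cases hz : z = x
    · subst hz; simp [toppleOne]; omega
    · simp [toppleOne, hz, List.count_cons, Ne.symm hz]

lemma sz_le {s t : ARWState} (h : s.val ≤ t.val) : s.sz ≤ t.sz := by
  cases s with
  | num n =>
    cases t with
    | num m => simpa [ARWState.val, sz_num, sz_rho] using h
    | rho =>
      simp only [ARWState.val, sz_num, sz_rho] at h ⊢
      have : (n : ℚ) ≤ (1 : ℕ) := by push_cast; linarith
      exact_mod_cast this
  | rho =>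
    cases t with
    | num m =>
      simp only [ARWState.val, sz_num, sz_rho] at h ⊢
      rcases Nat.eq_zero_or_pos m with rfl | hm
      · norm_num at h
      · exact hm
    | rho => exact le_rfl

lemma eq_rho {s : ARWState} (h : s.val ≤ ARWState.rho.val) (h1 : s.sz = 1) : s = .rho := by
  cases s with
  | num n =>
    simp only [sz_num, sz_rho] at h1
    subst h1
    norm_num [ARWState.val] at h
  | rho => rfl

lemma unstable_of_le (ξ : Stacks) (η η' : Config) (hle : ConfigLE η η')
    (p q : Config × (ℤ → ℕ)) (hp : ArwInv ξ η p) (hq : ArwInv ξ η' q)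
    (hh : ∀ z, p.2 z ≤ q.2 z) (x : ℤ) (hx : p.2 x = q.2 x) (hu : Unstable p.1 x) :
    Unstable q.1 x := by
  obtain ⟨n, hn, hpx⟩ := hu
  obtain ⟨a1, a2, a3⟩ := hp x
  obtain ⟨b1, b2, b3⟩ := hq x
  have hs := sz_le (hle x)
  have hA : arr ξ p.2 x ≤ arr ξ q.2 x :=
    add_le_add (Nat.count_monotone _ (hh _)) (Nat.count_monotone _ (hh _))
  rw [hx, hpx] at a1
  simp only [sz_num, sz_rho] at a1
  cases hqx : q.1 x with
  | num m =>
    rw [hqx] at b1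
    simp only [sz_num, sz_rho] at b1
    exact ⟨m, by omega, hqx⟩
  | rho =>
    exfalso
    rw [hqx] at b1 b3
    have hr : ARWState.rho.sz = 1 := rfl
    rw [hr] at b1
    have hn1 : n = 1 := by omega
    have hse : (η x).sz = (η' x).sz := by omega
    subst hn1
    have hL' : LastSl ξ η' x (q.2 x) := by
      by_contra hc
      obtain ⟨m, hm⟩ := b3 hc
      cases hm
    have hL : LastSl ξ η x (p.2 x) := by
      rw [hx]
      cases hk : q.2 x with
      | zero =>
        rw [hk] at hL'
        simp only [LastSl] at hL' ⊢
        have := hle x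
        rw [hL'] at this hse
        exact eq_rho this hse
      | succ k => rw [hk] at hL'; exact hL'
    rcases a2 hL with h | ⟨m, h⟩ <;> rw [hpx] at h <;> cases h

lemma count_le (ξ : Stacks) (η η' : Config) (hle : ConfigLE η η') (V : Set ℤ)
    (q : Config × (ℤ → ℕ)) (hq : ArwInv ξ η' q) (hst : ∀ x ∈ V, ¬ Unstable q.1 x)
    (α : List ℤ) : ∀ p : Config × (ℤ → ℕ), LegalFrom ξ α p → ContainedIn α V → ArwInv ξ η p →
    (∀ z, p.2 z ≤ q.2 z) → ∀ z, p.2 z + α.count z ≤ q.2 z := by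
  induction α with
  | nil => intro p _ _ _ h z; simpa using h z
  | cons x α ih =>
    intro p hl hV hp hh z
    have hne : p.2 x ≠ q.2 x := fun e =>
      hst x (hV x (by simp)) (unstable_of_le ξ η η' hle p q hp hq hh x e hl.1)
    have hlt := lt_of_le_of_ne (hh x) hne
    have := ih (toppleOne ξ x p) hl.2 (fun y hy => hV y (by simp [hy]))
      (inv_step ξ η x p hl.1 hp) (fun y => by
        by_cases hy : y = x
        · subst hy; simpa [toppleOne] using hlt
        · simpa [toppleOne, hy] using hh y) z
    have e := odo_seq ξ (x :: α) p z
    rw [toppleSeq, odo_seq] at e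
    omega

/-- **Monotonicity of the odometer.**  Let `V ⊆ V'` and `η ≤ η'`.  If `α` is a legal toppling
sequence for `η` contained in `V` stabilizing `η` in `V`, and `α'` is a legal toppling
sequence for `η'` contained in `V'` stabilizing `η'` in `V'`, then `u_{η,V} = h_α ≤ h_{α'}
= u_{η',V'}` pointwise.  (By the Abelian property `h_α` and `h_{α'}` do not depend on the
choice of such `α`, `α'`, so this states `u_{η,V} ≤ u_{η',V'}`.) -/
theorem odometer_monotone (ξ : Stacks) (η η' : Config) (V V' : Set ℤ)
    (hV : V ⊆ V') (hle : ConfigLE η η')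
    (α : List ℤ) (hαleg : LegalSeq ξ α η) (hαV : ContainedIn α V)
    (hαstab : StabilizesIn ξ α η V)
    (α' : List ℤ) (hα'leg : LegalSeq ξ α' η') (hα'V : ContainedIn α' V')
    (hα'stab : StabilizesIn ξ α' η' V') :
    ∀ x : ℤ, α.count x ≤ α'.count x := by
  have hq := inv_seq ξ η' α' _ hα'leg (inv_init ξ η')
  intro x
  have := count_le ξ η η' hle V _ hq (fun y hy => hα'stab y (hV hy)) α _ hαleg hαV
    (inv_init ξ η) (fun z => Nat.zero_le _) x
  rw [odo_seq] at this
  simpa using this
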